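/- (Generalized open-loop family under LDS) Fix an integer ℓ ≥ 2. Assume C is compact and convex, let (x_t) be the Frank–Wolfe iterates generated by the open-loop rule γ_t = ℓ/(t + ℓ), and suppose C together with its LMO satisfies local dual sharpness around the minimizer set 𝓜 = argmin_{x∈C} f(x) with some constants (A, q), q ≥ 2. Then (t + ℓ)(f(x_t) − f*) → 0; in particular f(x_t) − f* = o(1/t). -/

import Mathlib

open scoped RealInnerProductSpace
open Filter

/-- First-order characterization of convexity: a convex function lies above its tangents. -/
lemma ConvexOn.add_inner_gradient_le {E : Type*} [NormedAddCommGroup E] [InnerProductSpace ℝ E]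
    [CompleteSpace E] {f : E → ℝ} (hf : ConvexOn ℝ Set.univ f) {x g : E}
    (hg : HasGradientAt f g x) (y : E) : f x + ⟪g, y - x⟫ ≤ f y := by
  have hconv : ConvexOn ℝ Set.univ (f ∘ AffineMap.lineMap (k := ℝ) x y) := by
    simpa using hf.comp_affineMap (AffineMap.lineMap (k := ℝ) x y)
  have hderiv : HasDerivAt (f ∘ AffineMap.lineMap (k := ℝ) x y) ⟪g, y - x⟫ 0 := by
    have h := hg.hasFDerivAt.comp_hasDerivAt_of_eq (0 : ℝ)
      (AffineMap.hasDerivAt_lineMap (a := x) (b := y)) (by simp)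
    simpa using h
  have h := hconv.le_slope_of_hasDerivAt (Set.mem_univ 0) (Set.mem_univ 1) one_pos hderiv
  simp [slope_def_field] at h
  linarith

/-- A sequence whose excess over `δ` contracts by the factors `1 - 1/(t + a)` is eventually at
most `2δ`. -/
lemma eventually_le_of_excess_contracts {w : ℕ → ℝ} {a δ : ℝ} (ha : 2 ≤ a) (hδ : 0 < δ)
    (h : ∀ᶠ t : ℕ in atTop, w (t + 1) - δ ≤ (1 - 1 / ((t : ℝ) + a)) * max (w t - δ) 0) :
    ∀ᶠ t in atTop, w t ≤ 2 * δ := by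
  obtain ⟨N, hN⟩ := eventually_atTop.1 h
  have key : ∀ t ≥ N, max (w t - δ) 0 * ((t : ℝ) + a - 1)
      ≤ max (w N - δ) 0 * ((N : ℝ) + a - 1) := by
    intro t ht
    induction t, ht using Nat.le_induction with
    | base => exact le_rfl
    | succ t ht ih =>
      refine le_trans ?_ ih
      have ht0 : (0 : ℝ) ≤ t := t.cast_nonneg
      have hT : 0 < (t : ℝ) + a := by linarith
      have hfac : (1 - 1 / ((t : ℝ) + a)) * ((t : ℝ) + a) = (t : ℝ) + a - 1 := by
        field_simp
      have hfac0 : 0 ≤ 1 - 1 / ((t : ℝ) + a) := by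
        rw [sub_nonneg, div_le_one hT]; linarith
      have hmax : max (w (t + 1) - δ) 0 ≤ (1 - 1 / ((t : ℝ) + a)) * max (w t - δ) 0 :=
        max_le (hN t ht) (mul_nonneg hfac0 (le_max_right _ _))
      calc max (w (t + 1) - δ) 0 * (((t + 1 : ℕ) : ℝ) + a - 1)
          = max (w (t + 1) - δ) 0 * ((t : ℝ) + a) := by push_cast; ring
        _ ≤ (1 - 1 / ((t : ℝ) + a)) * max (w t - δ) 0 * ((t : ℝ) + a) := by gcongr
        _ = max (w t - δ) 0 * ((t : ℝ) + a - 1) := by rw [← hfac]; ring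
  have hlarge : ∀ᶠ t : ℕ in atTop, max (w N - δ) 0 * ((N : ℝ) + a - 1) / δ ≤ (t : ℝ) :=
    tendsto_natCast_atTop_atTop.eventually_ge_atTop _
  filter_upwards [hlarge, eventually_ge_atTop N] with t ht htN
  have hk := key t htN
  rw [div_le_iff₀ hδ] at ht
  have ht0 : (0 : ℝ) ≤ t := t.cast_nonneg
  by_contra! hlt
  have h1 : δ < max (w t - δ) 0 := lt_max_of_lt_left (by linarith)
  nlinarith

/-- One step of the open-loop recursion, measured by `T * h` with `T = t + ℓ`. -/
lemma excess_contracts_of_gap_ge {T l h h' g B K δ : ℝ} (hl : 2 ≤ l) (hK : 1 ≤ K)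
    (hT : 1 ≤ T) (hKT : K ≤ T) (hh : 0 ≤ h) (hB : 0 ≤ B) (hg : K * h ≤ g)
    (hδ : 2 * B * l ^ 2 ≤ K * δ) (hstep : h' ≤ h - l / T * g + B * (l / T) ^ 2) :
    (T + 1) * h' - δ ≤ (1 - 1 / T) * max (T * h - δ) 0 := by
  have hT0 : 0 < T := by linarith
  have h1 : h' ≤ h - l / T * (K * h) + B * (l / T) ^ 2 := by
    have : l / T * (K * h) ≤ l / T * g := by gcongr
    linarith
  have hmain : (T + 1) * h' - δ ≤ (1 - K / T) * (T * h - δ) := by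
    have h2 : (T + 1) * h' ≤ (T + 1) * (h - l / T * (K * h) + B * (l / T) ^ 2) := by gcongr
    have h3 : (1 - K / T) * (T * h - δ) + δ
        - (T + 1) * (h - l / T * (K * h) + B * (l / T) ^ 2)
        = h * (l * K - 1 - K) + l * K * h / T
          + ((K * δ - 2 * B * l ^ 2) * T + B * l ^ 2 * (T - 1)) / T ^ 2 := by
      field_simp
      ring
    have h4 : 0 ≤ h * (l * K - 1 - K) := mul_nonneg hh (by nlinarith)
    have h5 : 0 ≤ l * K * h / T := by positivity
    have h6 : 0 ≤ ((K * δ - 2 * B * l ^ 2) * T + B * l ^ 2 * (T - 1)) / T ^ 2 := by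
      apply div_nonneg _ (by positivity)
      have := mul_nonneg (sub_nonneg.2 hδ) hT0.le
      have := mul_nonneg (mul_nonneg hB (sq_nonneg l)) (sub_nonneg.2 hT)
      linarith
    linarith
  refine hmain.trans ?_
  have hK0 : 0 ≤ 1 - K / T := by rw [sub_nonneg, div_le_one hT0]; exact hKT
  calc (1 - K / T) * (T * h - δ) ≤ (1 - K / T) * max (T * h - δ) 0 := by
        gcongr; exact le_max_left _ _
    _ ≤ (1 - 1 / T) * max (T * h - δ) 0 := by gcongr

/-- Along a sequence in a compact set whose values tend to the minimum, the distance to the set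
of minimizers tends to zero. -/
lemma IsCompact.eventually_infDist_minimizers_lt {E : Type*} [PseudoMetricSpace E] {C : Set E}
    (hC : IsCompact C) {f : E → ℝ} (hf : Continuous f) {m : ℝ} (hm : IsLeast (f '' C) m)
    {x : ℕ → E} (hx : ∀ t, x t ∈ C) (hlim : Tendsto (fun t => f (x t)) atTop (nhds m))
    {r : ℝ} (hr : 0 < r) :
    ∀ᶠ t in atTop, Metric.infDist (x t) {y | y ∈ C ∧ f y = m} < r := by
  set M := {y | y ∈ C ∧ f y = m}
  have hfar : IsCompact (C ∩ {y | r ≤ Metric.infDist y M}) :=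
    hC.inter_right (isClosed_le continuous_const (Metric.continuous_infDist_pt M))
  rcases (C ∩ {y | r ≤ Metric.infDist y M}).eq_empty_or_nonempty with he | hne
  · refine Eventually.of_forall fun t => ?_
    by_contra! h
    exact he.subset ⟨hx t, h⟩
  · obtain ⟨y, ⟨hyC, hyr⟩, hy⟩ := hfar.exists_isMinOn hne hf.continuousOn
    have hlt : m < f y := by
      refine lt_of_le_of_ne (hm.2 ⟨y, hyC, rfl⟩) fun h => ?_
      have : Metric.infDist y M = 0 := Metric.infDist_zero_of_mem ⟨hyC, h.symm⟩
      have hyr' : r ≤ Metric.infDist y M := hyr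
      linarith
    filter_upwards [hlim.eventually_lt_const hlt] with t ht
    by_contra! h
    exact absurd (hy ⟨hx t, h⟩) (not_le.2 ht)

/-- **Generalized open-loop family under LDS.**
Fix an integer `ℓ ≥ 2`. If `C` together with its LMO satisfies local dual sharpness
around the minimizer set `𝓜` with constants `(A,q)`, `q ≥ 2`, then the Frank–Wolfe
iterates generated by the open-loop rule `γ_t = ℓ/(t+ℓ)` satisfy
`(t+ℓ)(f(x_t) - f*) → 0`; in particular `f(x_t) - f* = o(1/t)`. -/
theorem lds_generalized_open_loop
    {d : ℕ} {C : Set (EuclideanSpace ℝ (Fin d))}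
    (hCne : C.Nonempty) (hCcomp : IsCompact C) (hCconv : Convex ℝ C)
    {f : EuclideanSpace ℝ (Fin d) → ℝ}
    {f' : EuclideanSpace ℝ (Fin d) → EuclideanSpace ℝ (Fin d)}
    (hfconv : ConvexOn ℝ Set.univ f)
    (hgrad : ∀ y, HasGradientAt f (f' y) y)
    {L : ℝ} (hL : 0 < L)
    (hsmooth : ∀ x ∈ C, ∀ y ∈ C,
      f y ≤ f x + ⟪f' x, y - x⟫ + L / 2 * ‖y - x‖ ^ 2)
    {fstar : ℝ} (hfstar : IsLeast (f '' C) fstar)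
    {lmo : EuclideanSpace ℝ (Fin d) → EuclideanSpace ℝ (Fin d)}
    (hlmo : ∀ g, lmo g ∈ C ∧ ∀ y ∈ C, ⟪g, lmo g⟫ ≤ ⟪g, y⟫)
    {A q : ℝ} (hA : 0 < A) (hq : 2 ≤ q)
    (hLDS : ∃ ρ > (0 : ℝ), ∀ x ∈ C,
      Metric.infDist x {y | y ∈ C ∧ f y = fstar} < ρ →
      ∀ g : EuclideanSpace ℝ (Fin d),
        A * ‖g‖ * ‖x - lmo g‖ ^ q ≤ ⟪g, x - lmo g⟫)
    {ℓ : ℕ} (hℓ : 2 ≤ ℓ)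
    {x s : ℕ → EuclideanSpace ℝ (Fin d)} {γ : ℕ → ℝ}
    (hx0 : x 0 ∈ C)
    (hs : ∀ t, s t = lmo (f' (x t)))
    (hupd : ∀ t, x (t + 1) = x t + γ t • (s t - x t))
    (hγ : ∀ t, γ t = (ℓ : ℝ) / ((t : ℝ) + ℓ)) :
    Tendsto (fun t : ℕ => ((t : ℝ) + ℓ) * (f (x t) - fstar)) atTop (nhds 0)
    ∧ Tendsto (fun t : ℕ => (t : ℝ) * (f (x t) - fstar)) atTop (nhds 0) := by
  have hℓ' : (2 : ℝ) ≤ ℓ := by exact_mod_cast hℓ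
  have hfcont : Continuous f := continuous_iff_continuousAt.2 fun y => (hgrad y).continuousAt
  have hsC : ∀ t, s t ∈ C := fun t => hs t ▸ (hlmo _).1
  have hxC : ∀ t, x t ∈ C := by
    intro t
    induction t with
    | zero => exact hx0
    | succ t ih =>
      rw [hupd, hγ]
      refine hCconv.add_smul_sub_mem ih (hsC t) ⟨by positivity, ?_⟩
      exact div_le_one_of_le₀ (by linarith [t.cast_nonneg (α := ℝ)]) (by positivity)
  have hh0 : ∀ t, 0 ≤ f (x t) - fstar := fun t => sub_nonneg.2 (hfstar.2 ⟨x t, hxC t, rfl⟩)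
  set M := {y | y ∈ C ∧ f y = fstar}
  have hMcomp : IsCompact M := hCcomp.inter_right (isClosed_eq hfcont continuous_const)
  have hMne : M.Nonempty := by
    obtain ⟨y, hy, hyf⟩ := hfstar.1
    exact ⟨y, hy, hyf⟩
  have hgap_min : ∀ t, ∀ y ∈ M, f (x t) - fstar ≤ ⟪f' (x t), x t - y⟫ := by
    intro t y hy
    have h := hfconv.add_inner_gradient_le (hgrad (x t)) y
    rw [hy.2, ← neg_sub (x t) y, inner_neg_right] at h
    linarith
  have hgap : ∀ t, f (x t) - fstar ≤ ⟪f' (x t), x t - s t⟫ := by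
    intro t
    obtain ⟨y, hy⟩ := hMne
    have h1 := hgap_min t y hy
    have h2 := (hlmo (f' (x t))).2 y hy.1
    rw [← hs] at h2
    rw [inner_sub_right] at h1 ⊢
    linarith
  have hdist : ∀ t, f (x t) - fstar ≤ ‖f' (x t)‖ * Metric.infDist (x t) M := by
    intro t
    obtain ⟨y, hy, hyd⟩ := hMcomp.exists_infDist_eq_dist hMne (x t)
    rw [hyd, dist_eq_norm]
    exact (hgap_min t y hy).trans (real_inner_le_norm _ _)
  have hstep : ∀ t, ∀ e : ℝ, ‖x t - s t‖ ≤ e →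
      f (x (t + 1)) - fstar ≤ (f (x t) - fstar)
        - (ℓ : ℝ) / ((t : ℝ) + ℓ) * ⟪f' (x t), x t - s t⟫
        + L / 2 * e ^ 2 * ((ℓ : ℝ) / ((t : ℝ) + ℓ)) ^ 2 := by
    intro t e he
    have h := hsmooth _ (hxC t) _ (hxC (t + 1))
    have hdiff : x (t + 1) - x t = -(γ t • (x t - s t)) := by
      rw [hupd, ← smul_neg, neg_sub]; abel
    rw [hdiff, inner_neg_right, inner_smul_right, norm_neg, norm_smul, mul_pow, Real.norm_eq_abs,
      sq_abs, hγ] at h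
    have h2 : L / 2 * (((ℓ : ℝ) / ((t : ℝ) + ℓ)) ^ 2 * ‖x t - s t‖ ^ 2)
        ≤ L / 2 * (((ℓ : ℝ) / ((t : ℝ) + ℓ)) ^ 2 * e ^ 2) := by gcongr
    linarith
  obtain ⟨D, hDpos, hD⟩ : ∃ D > 0, ∀ t, ‖x t - s t‖ ≤ D := by
    obtain ⟨D, hD⟩ := Metric.isBounded_iff.1 hCcomp.isBounded
    refine ⟨max D 1, by positivity, fun t => ?_⟩
    rw [← dist_eq_norm]
    exact (hD (hxC t) (hsC t)).trans (le_max_left _ _)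
  have hcontract : ∀ t : ℕ, ∀ e K δ : ℝ, ‖x t - s t‖ ≤ e → 1 ≤ K → K ≤ (t : ℝ) + ℓ →
      K * (f (x t) - fstar) ≤ ⟪f' (x t), x t - s t⟫ → L * e ^ 2 * (ℓ : ℝ) ^ 2 ≤ K * δ →
      (((t + 1 : ℕ) : ℝ) + ℓ) * (f (x (t + 1)) - fstar) - δ
        ≤ (1 - 1 / ((t : ℝ) + ℓ)) * max (((t : ℝ) + ℓ) * (f (x t) - fstar) - δ) 0 := by
    intro t e K δ he hK hKT hg hδ
    have h := excess_contracts_of_gap_ge (δ := δ) hℓ' hK (hK.trans hKT) hKT (hh0 t)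
      (by positivity : 0 ≤ L / 2 * e ^ 2) hg (by linarith) (hstep t e he)
    have hcast : (((t + 1 : ℕ) : ℝ) + ℓ) = (t : ℝ) + ℓ + 1 := by push_cast; ring
    rw [hcast]
    exact h
  have hTtop : Tendsto (fun t : ℕ => (t : ℝ) + ℓ) atTop atTop :=
    tendsto_atTop_add_const_right _ _ tendsto_natCast_atTop_atTop
  have hvals : Tendsto (fun t => f (x t)) atTop (nhds fstar) := by
    have hbdd := eventually_le_of_excess_contracts
      (w := fun t : ℕ => ((t : ℝ) + ℓ) * (f (x t) - fstar)) (δ := L * D ^ 2 * (ℓ : ℝ) ^ 2) hℓ'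
      (by positivity) (Eventually.of_forall fun t : ℕ =>
        hcontract t D 1 _ (hD t) le_rfl (by linarith [t.cast_nonneg (α := ℝ)])
          (by simpa using hgap t) (one_mul _).ge)
    have hlim : Tendsto (fun t => f (x t) - fstar) atTop (nhds 0) := by
      refine tendsto_of_tendsto_of_tendsto_of_le_of_le' tendsto_const_nhds
        (hTtop.const_div_atTop (2 * (L * D ^ 2 * (ℓ : ℝ) ^ 2)))
        (Eventually.of_forall hh0) ?_
      filter_upwards [hbdd] with t ht
      rw [le_div_iff₀ (by positivity)]
      linarith
    simpa using hlim.add_const fstar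
  obtain ⟨ρ, hρ, hsharp⟩ := hLDS
  have hsmall : ∀ δ > 0, ∀ᶠ t : ℕ in atTop, ((t : ℝ) + ℓ) * (f (x t) - fstar) ≤ 2 * δ := by
    intro δ hδ
    refine eventually_le_of_excess_contracts hℓ' hδ ?_
    obtain ⟨ε, hε, hεδ⟩ : ∃ ε > 0, L * ε ^ 2 * (ℓ : ℝ) ^ 2 ≤ δ := by
      refine ⟨√(δ / (L * (ℓ : ℝ) ^ 2)), by positivity, ?_⟩
      rw [Real.sq_sqrt (by positivity)]
      exact le_of_eq (by field_simp)
    set K := max 1 (L * D ^ 2 * (ℓ : ℝ) ^ 2 / δ)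
    have hK1 : 1 ≤ K := le_max_left _ _
    have hKδ : L * D ^ 2 * (ℓ : ℝ) ^ 2 ≤ K * δ := by
      rw [← div_le_iff₀ hδ]; exact le_max_right _ _
    have hK0 : 0 < K := by linarith
    filter_upwards [hCcomp.eventually_infDist_minimizers_lt hfcont hfstar hxC hvals hρ,
      hCcomp.eventually_infDist_minimizers_lt hfcont hfstar hxC hvals
        (by positivity : 0 < A * ε ^ q / K),
      hTtop.eventually_ge_atTop K] with t htρ htK hKT
    rcases le_total ‖x t - s t‖ ε with hle | hge
    · exact hcontract t ε 1 δ hle le_rfl (hK1.trans hKT) (by simpa using hgap t)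
        (by simpa using hεδ)
    · refine hcontract t D K δ (hD t) hK1 hKT ?_ hKδ
      have hlds := hsharp _ (hxC t) htρ (f' (x t))
      rw [← hs] at hlds
      calc K * (f (x t) - fstar) ≤ K * (‖f' (x t)‖ * Metric.infDist (x t) M) := by
            gcongr; exact hdist t
        _ = ‖f' (x t)‖ * (Metric.infDist (x t) M * K) := by ring
        _ ≤ ‖f' (x t)‖ * (A * ε ^ q) := 
            mul_le_mul_of_nonneg_left ((lt_div_iff₀ hK0).1 htK).le (norm_nonneg _)
        _ ≤ ‖f' (x t)‖ * (A * ‖x t - s t‖ ^ q) := by gcongr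
        _ = A * ‖f' (x t)‖ * ‖x t - s t‖ ^ q := by ring
        _ ≤ _ := hlds
  have hmain : Tendsto (fun t : ℕ => ((t : ℝ) + ℓ) * (f (x t) - fstar)) atTop (nhds 0) := by
    refine Metric.tendsto_nhds.2 fun ε hε => ?_
    filter_upwards [hsmall (ε / 4) (by positivity)] with t ht
    rw [Real.dist_0_eq_abs, abs_of_nonneg (mul_nonneg (by positivity) (hh0 t))]
    linarith
  refine ⟨hmain, squeeze_zero (fun t => mul_nonneg t.cast_nonneg (hh0 t)) (fun t => ?_) hmain⟩
  exact mul_le_mul_of_nonneg_right (by linarith) (hh0 t)
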